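/- arXiv:2009.05606 — 3 statements merged into one kernel-verified Lean document; each statement's English description precedes it below -/
import Mathlib

section
/- In the combinatorial setup below, for every n ≥ 1 one has F̄_K(y_n, y_{n+1}) ≤ λ_{n+1} + (n+1)/2^n. -/
open MeasureTheory Filter Set
open scoped ENNReal NNReal

noncomputable section

/-- An `(n,δ)`-match between the sequences `x` and `y`, for the distance function `d`:
an order-preserving bijection `p` from `D` onto `R`, with `D, R ⊆ {0, …, n-1}`, such that
`d (x i) (y (p i)) < δ` for all `i ∈ D`.  The fit size of the match is `D.card`. -/
def IsMatch {X : Type*} (d : X → X → ℝ) (x y : ℕ → X) (n : ℕ) (δ : ℝ)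
    (D R : Finset ℕ) (p : ℕ → ℕ) : Prop :=
  (∀ i ∈ D, i < n) ∧ (∀ j ∈ R, j < n) ∧ Set.BijOn p ↑D ↑R ∧
  (∀ i ∈ D, ∀ j ∈ D, i < j → p i < p j) ∧ (∀ i ∈ D, d (x i) (y (p i)) < δ)

/-- The maximal fit size of an `(n,δ)`-match between `x` and `y`. -/
def maxFit {X : Type*} (d : X → X → ℝ) (x y : ℕ → X) (n : ℕ) (δ : ℝ) : ℕ :=
  sSup {m : ℕ | ∃ D R p, IsMatch d x y n δ D R p ∧ D.card = m}

/-- The `(n,δ)`-gap function `f̄_{n,δ}(x,y)`. -/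
def gapFn {X : Type*} (d : X → X → ℝ) (x y : ℕ → X) (n : ℕ) (δ : ℝ) : ℝ :=
  1 - (maxFit d x y n δ : ℝ) / n

/-- The `f̄_δ`-pseudo-distance: `f̄_δ(x,y) = limsup_n f̄_{n,δ}(x,y)`. -/
def gapDist {X : Type*} (d : X → X → ℝ) (x y : ℕ → X) (δ : ℝ) : ℝ :=
  Filter.limsup (fun n => gapFn d x y n δ) Filter.atTop

/-- The Feldman–Katok pseudometric `F̄_K(x,y) = inf {δ > 0 : f̄_δ(x,y) < δ}`. -/
def FKdist {X : Type*} (d : X → X → ℝ) (x y : ℕ → X) : ℝ :=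
  sInf {δ : ℝ | 0 < δ ∧ gapDist d x y δ < δ}


/-- The standard metric on the shift space `Σ_k = {1,…,k}^ℤ`:
`d(ξ,η) = 2^{-min{|j| : ξ_j ≠ η_j}}` (and `0` if `ξ = η`). -/
def shiftDist {k : ℕ} (ξ η : ℤ → Fin k) : ℝ :=
  haveI := Classical.propDecidable (ξ = η)
  if ξ = η then 0
  else (2 : ℝ) ^ (-((sInf {m : ℕ | ∃ j : ℤ, j.natAbs = m ∧ ξ j ≠ η j} : ℕ) : ℤ))

/-- The `σ`-periodic point of the shift generated by infinite repetition of the word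
`w 0, …, w (π - 1)` (so `w i` is the letter `ω_{i+1}` of the paper). -/
def perPoint {k : ℕ} (π : ℕ) (w : ℕ → Fin k) : ℤ → Fin k :=
  fun j => w (Int.toNat (j % (π : ℤ)))

/-- The `σ`-orbit sequence `(ξ, σξ, σ²ξ, …)` of a point `ξ` of the shift space. -/
def orbitSeq {k : ℕ} (ξ : ℤ → Fin k) : ℕ → (ℤ → Fin k) :=
  fun i j => ξ (j + i)

/-- `λ_n = R_n / (k_n π_{n-1})`. -/
def wordLam (π kseq Rseq : ℕ → ℕ) (n : ℕ) : ℝ :=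
  (Rseq n : ℝ) / ((kseq n : ℝ) * (π (n - 1) : ℝ))

theorem shiftDist_le_of_agree {k : ℕ} {ξ η : ℤ → Fin k} {m : ℕ}
    (h : ∀ j : ℤ, j.natAbs ≤ m → ξ j = η j) : shiftDist ξ η ≤ 1 / 2 ^ (m + 1) := by
  unfold shiftDist
  split_ifs with heq
  · positivity
  · have hne : {m : ℕ | ∃ j : ℤ, j.natAbs = m ∧ ξ j ≠ η j}.Nonempty := by
      obtain ⟨j, hj⟩ := Function.ne_iff.mp heq
      exact ⟨_, j, rfl, hj⟩
    have hle : m + 1 ≤ sInf {m : ℕ | ∃ j : ℤ, j.natAbs = m ∧ ξ j ≠ η j} := by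
      refine le_csInf hne ?_
      rintro b ⟨j, rfl, hj⟩
      by_contra hlt
      exact hj (h j (by omega))
    rw [zpow_neg, zpow_natCast, ← one_div]
    exact one_div_le_one_div_of_le (by positivity) (pow_le_pow_right₀ (by norm_num) hle)

theorem IsMatch.card_le {X : Type*} {d : X → X → ℝ} {x y : ℕ → X} {n : ℕ} {δ : ℝ}
    {D R : Finset ℕ} {p : ℕ → ℕ} (h : IsMatch d x y n δ D R p) : D.card ≤ n := by
  have hsub : D ⊆ Finset.range n := fun i hi => Finset.mem_range.mpr (h.1 i hi)
  simpa using Finset.card_le_card hsub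

theorem maxFit_le {X : Type*} (d : X → X → ℝ) (x y : ℕ → X) (n : ℕ) (δ : ℝ) :
    maxFit d x y n δ ≤ n := by
  refine csSup_le ⟨0, ∅, ∅, id, by simp [IsMatch], rfl⟩ ?_
  rintro m ⟨D, R, p, h, rfl⟩
  exact h.card_le

theorem IsMatch.card_le_maxFit {X : Type*} {d : X → X → ℝ} {x y : ℕ → X} {n : ℕ} {δ : ℝ}
    {D R : Finset ℕ} {p : ℕ → ℕ} (h : IsMatch d x y n δ D R p) :
    D.card ≤ maxFit d x y n δ := by
  refine le_csSup ⟨n, ?_⟩ ⟨D, R, p, h, rfl⟩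
  rintro m ⟨D, R, p, h, rfl⟩
  exact h.card_le

theorem gapFn_nonneg {X : Type*} (d : X → X → ℝ) (x y : ℕ → X) (n : ℕ) (δ : ℝ) :
    0 ≤ gapFn d x y n δ := by
  have h : (maxFit d x y n δ : ℝ) ≤ n := by exact_mod_cast maxFit_le d x y n δ
  exact sub_nonneg.mpr (div_le_one_of_le₀ h (Nat.cast_nonneg n))

/-- If `x` and `y` are close at all times `a * L + t` and `a * (L + r) + t` with
`m ≤ t < L - m`, then they have large matches. -/
theorem le_maxFit_of_blocks {X : Type*} {d : X → X → ℝ} {x y : ℕ → X} {δ : ℝ} {L r m : ℕ}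
    (h : ∀ a t : ℕ, m ≤ t → t + m < L → d (x (a * L + t)) (y (a * (L + r) + t)) < δ) (N : ℕ) :
    N / (L + r) * (L - m - m) ≤ maxFit d x y N δ := by
  set A := N / (L + r) with hA
  set f : ℕ × ℕ → ℕ := fun q => q.1 * L + q.2
  set S := Finset.range A ×ˢ Finset.Ico m (L - m)
  have hdivmod : ∀ q ∈ S, f q / L = q.1 ∧ f q % L = q.2 := by
    rintro ⟨a, t⟩ hq
    simp only [S, Finset.mem_product, Finset.mem_range, Finset.mem_Ico] at hq
    have htL : t < L := by omega
    simp only [f]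
    rw [mul_comm a L]
    exact ⟨by rw [Nat.mul_add_div (by omega), Nat.div_eq_of_lt htL, add_zero],
      by rw [Nat.mul_add_mod, Nat.mod_eq_of_lt htL]⟩
  have hinj : Set.InjOn f S := by
    intro q hq q' hq' heq
    have h1 := hdivmod q hq
    have h2 := hdivmod q' hq'
    rw [heq] at h1
    exact Prod.ext (h1.1.symm.trans h2.1) (h1.2.symm.trans h2.2)
  have hcard : (S.image f).card = A * (L - m - m) := by
    rw [Finset.card_image_of_injOn hinj]
    simp [S]
  set p : ℕ → ℕ := fun i => i + i / L * r
  have hp : ∀ q ∈ S, p (f q) = q.1 * (L + r) + q.2 := by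
    intro q hq
    simp only [p]
    rw [(hdivmod q hq).1]
    simp only [f]
    ring
  have hmono : StrictMono p := fun i j hij =>
    add_lt_add_of_lt_of_le hij (Nat.mul_le_mul_right r (Nat.div_le_div_right hij.le))
  have hlt : ∀ i ∈ S.image f, p i < N := by
    intro i hi
    obtain ⟨q, hq, rfl⟩ := Finset.mem_image.mp hi
    rw [hp q hq]
    simp only [S, Finset.mem_product, Finset.mem_range, Finset.mem_Ico] at hq
    have h1 : (q.1 + 1) * (L + r) ≤ A * (L + r) := Nat.mul_le_mul_right _ hq.1
    have h2 : A * (L + r) ≤ N := Nat.div_mul_le_self _ _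
    rw [add_mul, one_mul] at h1
    omega
  have hmatch : IsMatch d x y N δ (S.image f) ((S.image f).image p) p := by
    refine ⟨fun i hi => (Nat.le_add_right i _).trans_lt (hlt i hi), ?_, ?_,
      fun i _ j _ hij => hmono hij, ?_⟩
    · intro j hj
      obtain ⟨i, hi, rfl⟩ := Finset.mem_image.mp hj
      exact hlt i hi
    · rw [Finset.coe_image (s := S.image f)]
      exact hmono.injective.injOn.bijOn_image
    · intro i hi
      obtain ⟨q, hq, rfl⟩ := Finset.mem_image.mp hi
      rw [hp q hq]
      simp only [S, Finset.mem_product, Finset.mem_range, Finset.mem_Ico] at hq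
      exact h q.1 q.2 hq.2.1 (by omega)
  exact hcard ▸ hmatch.card_le_maxFit

theorem gapDist_le_of_blocks {X : Type*} {d : X → X → ℝ} {x y : ℕ → X} {δ : ℝ} {L r m : ℕ}
    (hL : 0 < L) (hm : 2 * m ≤ L)
    (h : ∀ a t : ℕ, m ≤ t → t + m < L → d (x (a * L + t)) (y (a * (L + r) + t)) < δ) :
    gapDist d x y δ ≤ (r + 2 * m) / (L + r) := by
  set g : ℕ → ℝ := fun N => (r + 2 * m) / (L + r) + (L - 2 * m) / N
  have hg : Tendsto g atTop (nhds ((r + 2 * m) / (L + r))) := by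
    simpa using (tendsto_const_nhds (x := ((r : ℝ) + 2 * m) / (L + r))).add
      (tendsto_const_div_atTop_nhds_zero_nat ((L : ℝ) - 2 * m))
  have hle : (fun N => gapFn d x y N δ) ≤ᶠ[atTop] g := by
    filter_upwards [eventually_gt_atTop 0] with N hN
    have hN' : (0 : ℝ) < N := by exact_mod_cast hN
    have hQ : (0 : ℝ) < L + r := by positivity
    have hm' : (2 * m : ℝ) ≤ L := by exact_mod_cast hm
    have hfit : ((N / (L + r) : ℕ) : ℝ) * (L - 2 * m) ≤ maxFit d x y N δ := by
      have h1 : ((N / (L + r) * (L - m - m) : ℕ) : ℝ) ≤ maxFit d x y N δ := by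
        exact_mod_cast le_maxFit_of_blocks h N
      rw [Nat.sub_sub, ← two_mul] at h1
      push_cast [Nat.cast_sub hm] at h1
      exact h1
    have hfloor : (N : ℝ) / (L + r) - 1 ≤ ((N / (L + r) : ℕ) : ℝ) := by
      have h1 : N < (N / (L + r) + 1) * (L + r) := by
        rw [mul_comm]
        exact Nat.lt_mul_div_succ N (by omega)
      have h2 : (N : ℝ) < (((N / (L + r) : ℕ) : ℝ) + 1) * (L + r) := by exact_mod_cast h1
      rw [sub_le_iff_le_add, div_le_iff₀ hQ]
      exact h2.le
    have hlow : ((N : ℝ) / (L + r) - 1) * (L - 2 * m) / N ≤ maxFit d x y N δ / N := by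
      gcongr
      exact (mul_le_mul_of_nonneg_right hfloor (by linarith)).trans hfit
    have hid : g N = 1 - ((N : ℝ) / (L + r) - 1) * (L - 2 * m) / N := by
      simp only [g]
      field_simp
      ring
    rw [hid]
    exact sub_le_sub_left hlow 1
  calc gapDist d x y δ ≤ limsup g atTop :=
        limsup_le_limsup hle
          (isCoboundedUnder_le_of_le atTop (x := 0) fun N => gapFn_nonneg d x y N δ)
          hg.isBoundedUnder_le
    _ = _ := hg.limsup_eq

theorem FKdist_le_of_gapDist_lt {X : Type*} {d : X → X → ℝ} {x y : ℕ → X} {δ : ℝ}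
    (hδ : 0 < δ) (h : gapDist d x y δ < δ) : FKdist d x y ≤ δ :=
  csInf_le ⟨0, fun _ hε => hε.1.le⟩ ⟨hδ, h⟩

/-- The orbits of `u u u ⋯` and of the periodic point whose word starts with `u ^ K` agree
around the times well inside corresponding copies of `u ^ K`. -/
theorem orbitSeq_perPoint_agree {k P K r m : ℕ} {u v : ℕ → Fin k}
    (huv : ∀ i < K * P, v i = u (i % P)) {a t : ℕ} (hmt : m ≤ t) (htm : t + m < K * P)
    {j : ℤ} (hj : j.natAbs ≤ m) :
    orbitSeq (perPoint P u) (a * (K * P) + t) j =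
      orbitSeq (perPoint (K * P + r) v) (a * (K * P + r) + t) j := by
  obtain ⟨s, hs⟩ := Int.eq_ofNat_of_zero_le (show 0 ≤ j + t by omega)
  have hsL : s < K * P := by omega
  have e1 : (j + ((a * (K * P) + t : ℕ) : ℤ)) % (P : ℤ) = ((s % P : ℕ) : ℤ) := by
    have : j + ((a * (K * P) + t : ℕ) : ℤ) = s + P * (a * K) := by
      push_cast
      rw [← hs]
      ring
    rw [this, Int.add_mul_emod_self_left]
    norm_cast
  have e2 : (j + ((a * (K * P + r) + t : ℕ) : ℤ)) % ((K * P + r : ℕ) : ℤ) = (s : ℤ) := by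
    have : j + ((a * (K * P + r) + t : ℕ) : ℤ) = s + ((K * P + r : ℕ) : ℤ) * a := by
      push_cast
      rw [← hs]
      ring
    rw [this, Int.add_mul_emod_self_left]
    exact Int.emod_eq_of_lt (by omega) (by exact_mod_cast hsL.trans_le (Nat.le_add_right _ r))
  simp only [orbitSeq, perPoint]
  rw [e1, e2, Int.toNat_natCast, Int.toNat_natCast, huv s hsL]

/-- In the combinatorial setup, for every `n ≥ 1`,
`F̄_K(y_n, y_{n+1}) ≤ λ_{n+1} + (n+1)/2^n`. -/
theorem FKdist_succ_le
    {k : ℕ} (π : ℕ → ℕ) (w : ℕ → ℕ → Fin k) (kseq Rseq : ℕ → ℕ)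
    (hπ0 : 0 < π 0)
    (hk : ∀ n, 1 ≤ n → 2 ≤ kseq n)
    (hR : ∀ n, 1 ≤ n → 1 ≤ Rseq n)
    (hrec : ∀ n, 1 ≤ n → π n = kseq n * π (n - 1) + Rseq n)
    (hword : ∀ n, 1 ≤ n → ∀ i < kseq n * π (n - 1), w n i = w (n - 1) (i % π (n - 1))) :
    ∀ n, 1 ≤ n →
      FKdist shiftDist (orbitSeq (perPoint (π n) (w n)))
          (orbitSeq (perPoint (π (n + 1)) (w (n + 1)))) ≤
        wordLam π kseq Rseq (n + 1) + ((n : ℝ) + 1) / 2 ^ n := by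
  intro n hn
  have hgrow : ∀ l, 2 ^ l ≤ π l := by
    intro l
    induction l with
    | zero => simpa using Nat.succ_le_of_lt hπ0
    | succ l ih =>
      rw [hrec (l + 1) (by omega), Nat.add_sub_cancel, pow_succ']
      exact (Nat.mul_le_mul (hk (l + 1) (by omega)) ih).trans (Nat.le_add_right _ _)
  have hword' := hword (n + 1) (by omega)
  have hK := hk (n + 1) (by omega)
  have hr := hR (n + 1) (by omega)
  have hQ := hrec (n + 1) (by omega)
  have hP := hgrow n
  unfold wordLam
  rw [Nat.add_sub_cancel] at *
  rw [hQ]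
  set P := π n
  set K := kseq (n + 1)
  set r := Rseq (n + 1)
  have hL : 2 * 2 ^ n ≤ K * P := Nat.mul_le_mul hK hP
  have hpow : n < 2 ^ n := Nat.lt_two_pow_self
  have hL' : (2 * 2 ^ n : ℝ) ≤ (K : ℝ) * P := by exact_mod_cast hL
  have hpow0 : (0 : ℝ) < 2 ^ n := by positivity
  have hLpos : (0 : ℝ) < (K : ℝ) * P := by linarith
  have hr' : (0 : ℝ) < r := by exact_mod_cast hr
  have hlam : 0 < (r : ℝ) / (K * P) := by positivity
  have hdist : (1 : ℝ) / 2 ^ (n + 1) < r / (K * P) + (n + 1) / 2 ^ n := by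
    have h1 : (1 : ℝ) / 2 ^ (n + 1) ≤ (n + 1) / 2 ^ n := by
      gcongr
      · linarith [(Nat.cast_nonneg n : (0 : ℝ) ≤ n)]
      · norm_num
      · omega
    linarith
  refine FKdist_le_of_gapDist_lt (by positivity) ?_
  refine (gapDist_le_of_blocks (L := K * P) (r := r) (m := n) (by omega) (by omega)
    fun a t hnt htn => ?_).trans_lt ?_
  · exact (shiftDist_le_of_agree fun j hj =>
      orbitSeq_perPoint_agree hword' hnt htn hj).trans_lt hdist
  · push_cast
    rw [add_div]
    have h1 : (r : ℝ) / (K * P + r) ≤ r / (K * P) := by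
      gcongr
      linarith
    have h2 : 2 * (n : ℝ) / (K * P + r) ≤ 2 * n / (2 * 2 ^ n) := by
      gcongr
      linarith
    have h3 : 2 * (n : ℝ) / (2 * 2 ^ n) < (n + 1) / 2 ^ n := by
      rw [mul_div_mul_left _ _ two_ne_zero]
      gcongr
      linarith
    linarith

end
end

section
/- For the locally constant skew product T on M = Σ_k × S¹ built from circle homeomorphisms f_1,…,f_k, the skew product carries no entropy in the fibers: for every ξ ∈ Σ_k, the Bowen topological entropy of T on the fiber π^{-1}(ξ) = {ξ} × S¹ is zero, i.e. h(T, π^{-1}(ξ)) := lim_{ε→0} limsup_{n→∞} (1/n) log r_n(ε, π^{-1}(ξ)) = 0, where r_n(ε, K) denotes the minimal cardinality of an (n,ε)-spanning set of K. -/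
open MeasureTheory Filter Set
open scoped ENNReal NNReal

noncomputable section

/-- The two-sided full shift space on `k` symbols. -/
abbrev Shift (k : ℕ) := ℤ → Fin k

/-- The shift map `σ`. -/
def shiftMap (k : ℕ) : Shift k → Shift k := fun ξ i => ξ (i + 1)

/-- The circle `S¹`, modelled as `ℝ/ℤ`. -/
abbrev Circle1 := AddCircle (1 : ℝ)

/-- The phase space `M = Σ_k × S¹`. -/
abbrev SkewM (k : ℕ) := Shift k × Circle1

/-- The metric `D((ξ,x),(ξ̂,x̂)) = max (d(ξ,ξ̂), d_{S¹}(x,x̂))` on `M = Σ_k × S¹`. -/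
def skewDist {k : ℕ} (z z' : SkewM k) : ℝ :=
  max (shiftDist z.1 z'.1) (dist z.2 z'.2)

/-- A locally constant skew product built from circle homeomorphisms. -/
structure HomeoSetup (k : ℕ) where
  f : Fin k → Circle1 ≃ₜ Circle1

/-- The skew product map `T(ξ,x) = (σξ, f_{ξ₀} x)`. -/
def HomeoSetup.T {k : ℕ} (S : HomeoSetup k) : SkewM k → SkewM k :=
  fun z => (shiftMap k z.1, S.f (z.1 0) z.2)

/-- The fiber `π^{-1}(ξ) = {ξ} × S¹` over a base point `ξ`. -/
def fiber {k : ℕ} (ξ : Shift k) : Set (SkewM k) :=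
  {ξ} ×ˢ (Set.univ : Set Circle1)

/-- `F` is an `(n,ε)`-spanning subset of `K` for the skew product `T` (with respect to
the metric `D`). -/
def IsSpanning {k : ℕ} (S : HomeoSetup k) (K : Set (SkewM k)) (n : ℕ) (ε : ℝ)
    (F : Finset (SkewM k)) : Prop :=
  ↑F ⊆ K ∧ ∀ z ∈ K, ∃ s ∈ F, ∀ i < n, skewDist (S.T^[i] z) (S.T^[i] s) < ε

/-- `r_n(ε, K)`: the minimal cardinality of an `(n,ε)`-spanning subset of `K`. -/
def spanNum {k : ℕ} (S : HomeoSetup k) (K : Set (SkewM k)) (n : ℕ) (ε : ℝ) : ℕ :=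
  sInf {m : ℕ | ∃ F : Finset (SkewM k), IsSpanning S K n ε F ∧ F.card = m}


/-- The fiber homeomorphism `f_{ξ_{n-1}} ∘ ⋯ ∘ f_{ξ_0}` induced by `T^n` on the fiber over `ξ`. -/
def HomeoSetup.fiberMap {k : ℕ} (S : HomeoSetup k) (ξ : Shift k) : ℕ → Circle1 ≃ₜ Circle1
  | 0 => Homeomorph.refl _
  | n + 1 => (S.fiberMap ξ n).trans (S.f ((shiftMap k)^[n] ξ 0))

theorem HomeoSetup.iterate_T {k : ℕ} (S : HomeoSetup k) (ξ : Shift k) (x : Circle1) (n : ℕ) :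
    S.T^[n] (ξ, x) = ((shiftMap k)^[n] ξ, S.fiberMap ξ n x) := by
  induction n with
  | zero => rfl
  | succ n ih => rw [Function.iterate_succ_apply', ih, Function.iterate_succ_apply']; rfl

theorem skewDist_same_base {k : ℕ} (ξ : Shift k) (x y : Circle1) :
    skewDist (ξ, x) (ξ, y) = dist x y := by
  simp [skewDist, shiftDist]

theorem Circle1.finite_sphere (c : Circle1) (r : ℝ) : (Metric.sphere c r).Finite := by
  refine (Set.toFinite {c + ((r : ℝ) : Circle1), c + ((-r : ℝ) : Circle1)}).subset ?_
  intro y hy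
  obtain ⟨t, ht⟩ := QuotientAddGroup.mk_surjective (y - c)
  have hyc : y = c + ((t - round t : ℝ) : Circle1) := by
    have hround : ((round t : ℝ) : Circle1) = 0 :=
      (AddCircle.coe_eq_zero_iff (1 : ℝ)).2 ⟨round t, by simp⟩
    rw [AddCircle.coe_sub, hround, sub_zero]
    exact (add_eq_of_eq_sub' ht).symm
  have hr : |t - round t| = r := by
    rw [← UnitAddCircle.norm_eq, ← hy, dist_eq_norm, ← ht]
  rw [hyc]
  rcases abs_choice (t - round t) with h | h
  · left; rw [← hr, h]
  · right; rw [← hr, h, neg_neg]; rfl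

/-- Finitely many points cut the circle into pieces of small size. -/
theorem Circle1.exists_finset_separating {ε : ℝ} (hε : 0 < ε) :
    ∃ P : Finset Circle1, ∀ A : Set Circle1, IsPreconnected A → Disjoint A ↑P →
      ∃ c, A ⊆ Metric.ball c ε := by
  obtain ⟨t, -, ht, hcover⟩ := finite_cover_balls_of_compact (isCompact_univ (X := Circle1)) hε
  have hfin : (⋃ c ∈ t, Metric.sphere c ε).Finite :=
    ht.biUnion fun c _ => Circle1.finite_sphere c ε
  refine ⟨hfin.toFinset, fun A hA hdisj => ?_⟩
  rcases A.eq_empty_or_nonempty with rfl | ⟨a, ha⟩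
  · exact ⟨0, Set.empty_subset _⟩
  obtain ⟨c, hc, hac⟩ := Set.mem_iUnion₂.1 (hcover (Set.mem_univ a))
  refine ⟨c, hA.subset_left_of_subset_union Metric.isOpen_ball
    Metric.isClosed_closedBall.isOpen_compl
    (Set.disjoint_compl_right_iff_subset.2 Metric.ball_subset_closedBall) ?_ ⟨a, ha, hac⟩⟩
  intro y hy
  rcases lt_trichotomy (dist y c) ε with h | h | h
  · exact Or.inl h
  · refine (Set.disjoint_left.1 hdisj hy ?_).elim
    rw [Set.Finite.coe_toFinset]
    exact Set.mem_biUnion hc h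
  · exact Or.inr fun hle => h.not_ge hle

/-- Finitely many circle homeomorphisms are simultaneously shadowed by a set of points whose
cardinality grows linearly in the number of homeomorphisms. -/
theorem Circle1.exists_card_le_spanning {ε : ℝ} (hε : 0 < ε) :
    ∃ C : ℕ, ∀ (g : ℕ → Circle1 ≃ₜ Circle1) (n : ℕ), ∃ F : Finset Circle1,
      F.card ≤ n * C + 1 ∧ ∀ x, ∃ s ∈ F, ∀ i < n, dist (g i x) (g i s) < ε := by
  classical
  obtain ⟨P, hP⟩ := Circle1.exists_finset_separating (show 0 < ε / 4 by positivity)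
  refine ⟨P.card, fun g n => ?_⟩
  let rep : Circle1 → ℝ := fun x => AddCircle.equivIco 1 0 x
  have rep_mem : ∀ x, rep x ∈ Set.Ico (0 : ℝ) 1 := fun x => by
    simpa using (AddCircle.equivIco 1 0 x).2
  have coe_rep : ∀ x, (rep x : Circle1) = x := fun x => AddCircle.coe_equivIco
  have rep_coe : ∀ t ∈ Set.Ico (0 : ℝ) 1, rep (t : Circle1) = t := fun t ht =>
    AddCircle.equivIco_coe_of_mem (by simpa using ht)
  let Q : Finset Circle1 := (Finset.range n).biUnion fun i => P.image (g i).symm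
  let R : Finset ℝ := insert 0 (Q.image rep)
  have hQ : Q.card ≤ n * P.card := by
    simpa using Finset.card_biUnion_le_card_mul (Finset.range n)
      (fun i => P.image (g i).symm) P.card fun i _ => Finset.card_image_le
  refine ⟨R.image fun t : ℝ => (t : Circle1), ?_, fun x => ?_⟩
  · calc (R.image fun t : ℝ => (t : Circle1)).card ≤ R.card := Finset.card_image_le
      _ ≤ (Q.image rep).card + 1 := Finset.card_insert_le _ _
      _ ≤ n * P.card + 1 := by gcongr; exact Finset.card_image_le.trans hQ
  obtain ⟨s, hs, hmax⟩ := Finset.exists_max_image (R.filter (· ≤ rep x)) id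
    ⟨0, by simp [R, (rep_mem x).1]⟩
  obtain ⟨hsR, hsx⟩ := Finset.mem_filter.1 hs
  refine ⟨s, Finset.mem_image_of_mem (fun t : ℝ => (t : Circle1)) hsR, fun i hi => ?_⟩
  rcases hsx.eq_or_lt with rfl | hlt
  · simpa [coe_rep] using hε
  have hs0 : 0 ≤ s := hmax 0 (by simp [R, (rep_mem x).1])
  let h : ℝ → Circle1 := fun t => g i (t : Circle1)
  have hcont : Continuous h := (g i).continuous.comp (AddCircle.continuous_mk' 1)
  have hdisj : Disjoint (h '' Set.Ioc s (rep x)) ↑P := by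
    rw [Set.disjoint_left]
    rintro _ ⟨t, ht, rfl⟩ htP
    have htQ : (t : Circle1) ∈ Q := Finset.mem_biUnion.2
      ⟨i, Finset.mem_range.2 hi, Finset.mem_image.2 ⟨h t, htP, (g i).symm_apply_apply _⟩⟩
    have htR : t ∈ R := Finset.mem_insert_of_mem (Finset.mem_image.2
      ⟨t, htQ, rep_coe t ⟨hs0.trans ht.1.le, ht.2.trans_lt (rep_mem x).2⟩⟩)
    exact (hmax t (Finset.mem_filter.2 ⟨htR, ht.2⟩)).not_gt ht.1
  obtain ⟨c, hc⟩ := hP _ (isPreconnected_Ioc.image h hcont.continuousOn) hdisj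
  have hsub : closure (Set.Ioc s (rep x)) ⊆ h ⁻¹' Metric.closedBall c (ε / 4) :=
    closure_minimal (fun t ht => Metric.ball_subset_closedBall (hc ⟨t, ht, rfl⟩))
      (Metric.isClosed_closedBall.preimage hcont)
  rw [closure_Ioc hlt.ne] at hsub
  have hdx : dist (h (rep x)) c ≤ ε / 4 := hsub (Set.right_mem_Icc.2 hlt.le)
  have hds : dist (h s) c ≤ ε / 4 := hsub (Set.left_mem_Icc.2 hlt.le)
  have hx : h (rep x) = g i x := congrArg (g i) (coe_rep x)
  rw [hx] at hdx
  calc dist (g i x) (h s) ≤ dist (g i x) c + dist (h s) c := dist_triangle_right _ _ _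
    _ < ε := by linarith

/-- The spanning numbers of a fiber grow at most linearly in time. -/
theorem exists_spanNum_fiber_le {k : ℕ} (S : HomeoSetup k) (ξ : Shift k) {ε : ℝ} (hε : 0 < ε) :
    ∃ C : ℕ, ∀ n, spanNum S (fiber ξ) n ε ≤ n * C + 1 := by
  classical
  obtain ⟨C, hC⟩ := Circle1.exists_card_le_spanning hε
  refine ⟨C, fun n => ?_⟩
  obtain ⟨F, hcard, hF⟩ := hC (S.fiberMap ξ) n
  have hspan : IsSpanning S (fiber ξ) n ε (F.image fun x => (ξ, x)) := by
    refine ⟨fun z hz => ?_, fun z hz => ?_⟩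
    · obtain ⟨x, -, rfl⟩ := Finset.mem_image.1 (Finset.mem_coe.1 hz)
      exact ⟨rfl, Set.mem_univ _⟩
    · obtain ⟨η, x⟩ := z
      obtain rfl : η = ξ := hz.1
      obtain ⟨s, hs, hd⟩ := hF x
      refine ⟨(η, s), Finset.mem_image_of_mem _ hs, fun i hi => ?_⟩
      rw [S.iterate_T, S.iterate_T, skewDist_same_base]
      exact hd i hi
  have hle : spanNum S (fiber ξ) n ε ≤ _ := Nat.sInf_le ⟨_, hspan, rfl⟩
  exact hle.trans (Finset.card_image_le.trans hcard)

theorem tendsto_log_div_of_le_linear {u : ℕ → ℕ} {C : ℕ} (hu : ∀ n, u n ≤ n * C + 1) :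
    Tendsto (fun n => Real.log (u n) / (n : ℝ)) atTop (nhds 0) := by
  have hlim : Tendsto (fun n : ℕ => Real.log (C + 1) / (n : ℝ) + Real.log n / (n : ℝ))
      atTop (nhds 0) := by
    have hlog : Tendsto (fun n : ℕ => Real.log n / (n : ℝ)) atTop (nhds 0) :=
      Real.isLittleO_log_id_atTop.tendsto_div_nhds_zero.comp tendsto_natCast_atTop_atTop
    simpa using (tendsto_const_div_atTop_nhds_zero_nat (Real.log (C + 1))).add hlog
  refine tendsto_of_tendsto_of_tendsto_of_le_of_le' tendsto_const_nhds hlim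
    (Eventually.of_forall fun n => div_nonneg (Real.log_natCast_nonneg _) n.cast_nonneg) ?_
  filter_upwards [eventually_ge_atTop 1] with n hn
  rw [← add_div]
  gcongr
  have hn' : (1 : ℝ) ≤ n := by exact_mod_cast hn
  rw [← Real.log_mul (by positivity) (by positivity)]
  rcases (u n).eq_zero_or_pos with h0 | hpos
  · rw [h0, Nat.cast_zero, Real.log_zero]
    refine Real.log_nonneg ?_
    nlinarith [(C.cast_nonneg : (0 : ℝ) ≤ C)]
  · refine Real.log_le_log (by exact_mod_cast hpos) ?_
    have : (u n : ℝ) ≤ n * C + 1 := by exact_mod_cast hu n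
    linarith

/-- The skew product carries no entropy in the fibers: for every
`ξ ∈ Σ_k`, the Bowen topological entropy of `T` on the fiber `{ξ} × S¹` vanishes:
`lim_{ε→0⁺} limsup_n (1/n) log r_n(ε, π^{-1}(ξ)) = 0`. -/
theorem fiber_entropy_zero {k : ℕ} (S : HomeoSetup k) (ξ : Shift k) :
    Tendsto
      (fun ε : ℝ =>
        Filter.limsup (fun n : ℕ => Real.log (spanNum S (fiber ξ) n ε) / (n : ℝ))
          Filter.atTop)
      (nhdsWithin 0 (Set.Ioi 0)) (nhds 0) := by
  refine tendsto_const_nhds.congr' ?_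
  filter_upwards [self_mem_nhdsWithin] with ε hε
  obtain ⟨C, hC⟩ := exists_spanNum_fiber_le S ξ hε
  exact (tendsto_log_div_of_le_linear hC).limsup_eq.symm

end
end

section
/- In the combinatorial setup below, define ρ_1 = 1/(1+λ_1) and ρ_{n+1} = ρ_n/(1+λ_{n+1}). Then for every n ≥ 1, the proportion of positions ℓ ∈ {1,…,π_n} that lie inside a copy of the initial block is at least ρ_n; that is, #{ℓ ∈ {1,…,π_n} : there exists j ∈ {1,…,π_0} with ω^n_{ℓ+i−j} = ω^0_i for every i = 1,…,π_0} / π_n ≥ ρ_n. -/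
noncomputable section

/-- The positions (counted from `0`) of the word `w 0, …, w (N - 1)` that are covered by an
occurrence of the block `b 0, …, b (L - 1)` inside this word. -/
def coveredPositions {k : ℕ} (L : ℕ) (b : ℕ → Fin k) (N : ℕ) (w : ℕ → Fin k) : Finset ℕ :=
  open Classical in
  {p ∈ Finset.range N | ∃ s ≤ p, p < s + L ∧ s + L ≤ N ∧ ∀ i < L, w (s + i) = b i}

theorem mem_coveredPositions {k L N p : ℕ} {b w : ℕ → Fin k} :
    p ∈ coveredPositions L b N w ↔
      p < N ∧ ∃ s ≤ p, p < s + L ∧ s + L ≤ N ∧ ∀ i < L, w (s + i) = b i := by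
  simp [coveredPositions]

theorem coveredPositions_self {k : ℕ} (L : ℕ) (b : ℕ → Fin k) :
    coveredPositions L b L b = Finset.range L := by
  ext p
  rw [mem_coveredPositions, Finset.mem_range]
  refine ⟨fun h => h.1, fun h => ⟨h, 0, by omega, by omega, by omega, fun i _ => ?_⟩⟩
  rw [Nat.zero_add]

/-- If a word starts with `c` repetitions of `v`, then it has at least `c` times as many
covered positions as `v`. -/
theorem mul_card_coveredPositions_le {k L M N c : ℕ} {b v w : ℕ → Fin k}
    (hN : c * M ≤ N) (hw : ∀ i < c * M, w i = v (i % M)) :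
    c * (coveredPositions L b M v).card ≤ (coveredPositions L b N w).card := by
  rw [← Finset.card_range c, ← Finset.card_product]
  refine Finset.card_le_card_of_injOn (fun x => x.1 * M + x.2) ?_ ?_
  · rintro ⟨m, p⟩ hx
    simp only [Finset.mem_coe, Finset.mem_product, Finset.mem_range, mem_coveredPositions] at hx
    obtain ⟨hm, hp, s, hsp, hps, hsM, hs⟩ := hx
    have hmM : m * M + M ≤ c * M := by
      rw [← Nat.succ_mul]
      exact Nat.mul_le_mul_right M hm
    change m * M + p ∈ coveredPositions L b N w
    refine mem_coveredPositions.2 ⟨by omega, m * M + s, by omega, by omega, by omega, ?_⟩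
    intro i hi
    rw [hw _ (by omega), Nat.add_assoc, Nat.mul_add_mod', Nat.mod_eq_of_lt (by omega)]
    exact hs i hi
  · rintro ⟨m, p⟩ hx ⟨m', p'⟩ hx' h
    simp only [Finset.mem_coe, Finset.mem_product, Finset.mem_range, mem_coveredPositions]
      at hx hx' h
    have hp : p = p' := by
      have := congrArg (· % M) h
      simpa [Nat.mod_eq_of_lt hx.2.1, Nat.mod_eq_of_lt hx'.2.1] using this
    subst hp
    have hM : 0 < M := by omega
    have hm : m = m' := Nat.eq_of_mul_eq_mul_right hM (by omega)
    rw [hm]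

/-- Covered positions, shifted to be counted from `1`, lie in a copy of the block in the
periodic point generated by the word. -/
theorem card_coveredPositions_le_ncard {k L N : ℕ} {b w : ℕ → Fin k} :
    (coveredPositions L b N w).card ≤
      {ℓ : ℕ | 1 ≤ ℓ ∧ ℓ ≤ N ∧ ∃ j, 1 ≤ j ∧ j ≤ L ∧ ∀ i, 1 ≤ i → i ≤ L →
        perPoint N w ((ℓ : ℤ) + (i : ℤ) - (j : ℤ) - 1) = b (i - 1)}.ncard := by
  rw [← Set.ncard_coe_finset]
  refine Set.ncard_le_ncard_of_injOn (· + 1) ?_ (add_left_injective 1).injOn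
    ((Set.finite_Icc 1 N).subset fun ℓ hℓ => ⟨hℓ.1, hℓ.2.1⟩)
  intro p hp
  obtain ⟨hpN, s, hsp, hps, hsN, hs⟩ := mem_coveredPositions.1 hp
  refine ⟨by omega, by omega, p - s + 1, by omega, by omega, fun i hi hiL => ?_⟩
  have hpos : ((p + 1 : ℕ) : ℤ) + (i : ℤ) - ((p - s + 1 : ℕ) : ℤ) - 1 =
      ((s + (i - 1) : ℕ) : ℤ) := by
    omega
  rw [hpos, perPoint, ← Int.natCast_mod, Int.toNat_natCast, Nat.mod_eq_of_lt (by omega)]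
  exact hs (i - 1) (by omega)

/-- Appending a remainder of length `R` to a word of length `a` rescales a density by
`1 / (1 + R / a)`. -/
theorem div_one_add_div_mul_add {a : ℝ} (ha : 0 < a) {R : ℝ} (hR : 0 ≤ R) (x : ℝ) :
    x / (1 + R / a) * (a + R) = x * a := by
  have : a + R ≠ 0 := by positivity
  field_simp

/-- In the combinatorial setup, with `ρ_1 = 1/(1+λ_1)` and
`ρ_{n+1} = ρ_n/(1+λ_{n+1})`, for every `n ≥ 1` the proportion of positions
`ℓ ∈ {1,…,π_n}` lying inside a copy of the initial block — i.e. such that there is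
`j ∈ {1,…,π_0}` with `ω^n_{ℓ+i-j} = ω^0_i` for every `i = 1,…,π_0` — is at least `ρ_n`. -/
theorem proportion_in_initial_block_ge
    {k : ℕ} (π : ℕ → ℕ) (w : ℕ → ℕ → Fin k) (kseq Rseq : ℕ → ℕ)
    (hπ0 : 0 < π 0)
    (hk : ∀ n, 1 ≤ n → 2 ≤ kseq n)
    (hR : ∀ n, 1 ≤ n → 1 ≤ Rseq n)
    (hrec : ∀ n, 1 ≤ n → π n = kseq n * π (n - 1) + Rseq n)
    (hword : ∀ n, 1 ≤ n → ∀ i < kseq n * π (n - 1), w n i = w (n - 1) (i % π (n - 1)))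
    (ρ : ℕ → ℝ)
    (hρ1 : ρ 1 = 1 / (1 + wordLam π kseq Rseq 1))
    (hρrec : ∀ n, 1 ≤ n → ρ (n + 1) = ρ n / (1 + wordLam π kseq Rseq (n + 1))) :
    ∀ n, 1 ≤ n →
      ρ n ≤ (({ℓ : ℕ | 1 ≤ ℓ ∧ ℓ ≤ π n ∧ ∃ j, 1 ≤ j ∧ j ≤ π 0 ∧
          ∀ i, 1 ≤ i → i ≤ π 0 →
            perPoint (π n) (w n) ((ℓ : ℤ) + (i : ℤ) - (j : ℤ) - 1) = w 0 (i - 1)}.ncard : ℝ))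
        / (π n : ℝ) := by
  have hπ : ∀ n, 0 < π n := by
    intro n
    rcases Nat.eq_zero_or_pos n with rfl | hn
    · exact hπ0
    · have := hrec n hn
      have := hR n hn
      omega
  have hcard : ∀ n, 1 ≤ n →
      kseq n * (coveredPositions (π 0) (w 0) (π (n - 1)) (w (n - 1))).card ≤
      (coveredPositions (π 0) (w 0) (π n) (w n)).card := fun n hn =>
    mul_card_coveredPositions_le (by rw [hrec n hn]; omega) (hword n hn)
  have hscale : ∀ n, 1 ≤ n → ∀ x : ℝ, x / (1 + wordLam π kseq Rseq n) * (π n : ℝ) =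
      kseq n * (x * (π (n - 1) : ℝ)) := by
    intro n hn x
    have hk0 : (0 : ℝ) < kseq n := by exact_mod_cast (hk n hn).trans_lt' two_pos
    have hπ' : (0 : ℝ) < π (n - 1) := by exact_mod_cast hπ (n - 1)
    have h := div_one_add_div_mul_add (mul_pos hk0 hπ') (Nat.cast_nonneg (Rseq n)) x
    rw [wordLam, hrec n hn]
    push_cast
    rw [h]
    ring
  have hcov : ∀ n, 1 ≤ n →
      ρ n * (π n : ℝ) ≤ (coveredPositions (π 0) (w 0) (π n) (w n)).card := by
    intro n hn
    induction n, hn using Nat.le_induction with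
    | base =>
      have h := hcard 1 le_rfl
      rw [Nat.sub_self, coveredPositions_self, Finset.card_range] at h
      rw [hρ1, hscale 1 le_rfl, Nat.sub_self, one_mul]
      exact_mod_cast h
    | succ n hn ih =>
      have h := hcard (n + 1) (by omega)
      rw [Nat.add_sub_cancel] at h
      rw [hρrec n hn, hscale (n + 1) (by omega), Nat.add_sub_cancel]
      refine (mul_le_mul_of_nonneg_left ih (Nat.cast_nonneg _)).trans ?_
      exact_mod_cast h
  intro n hn
  rw [le_div_iff₀ (by exact_mod_cast hπ n)]
  exact (hcov n hn).trans (by exact_mod_cast card_coveredPositions_le_ncard)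

end
end
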